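/- arXiv:1703.06946 — 7 statements merged into one kernel-verified Lean document; each statement's English description precedes it below -/
import Mathlib

section
/- Fix y ∈ ℝ^T and λ ≥ 0. Define β̂ = (1 − λ/‖(y)₊‖₂)₊ · (y)₊ when (y)₊ ≠ 0, and β̂ = 0 when (y)₊ = 0. Then β̂ is entrywise nonnegative, and for every entrywise-nonnegative β ∈ ℝ^T one has (1/2)‖y − β̂‖₂² + λ‖β̂‖₂ ≤ (1/2)‖y − β‖₂² + λ‖β‖₂; that is, β̂ minimizes (1/2)‖y − β‖₂² + λ‖β‖₂ over {β ∈ ℝ^T : β ≥ 0 entrywise}. -/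
/-- The Euclidean (ℓ2) norm of a vector in ℝ^T. -/
noncomputable def l2norm {n : ℕ} (v : Fin n → ℝ) : ℝ := Real.sqrt (∑ i, v i ^ 2)

/-- The elementwise positive part of a vector. -/
noncomputable def vecPosPart {n : ℕ} (v : Fin n → ℝ) : Fin n → ℝ := fun i => max (v i) 0

theorem l2norm_sq_aux {n : ℕ} (v : Fin n → ℝ) : l2norm v ^ 2 = ∑ i, v i ^ 2 :=
  Real.sq_sqrt (Finset.sum_nonneg fun i _ => sq_nonneg (v i))

theorem l2norm_nonneg_aux {n : ℕ} (v : Fin n → ℝ) : 0 ≤ l2norm v := Real.sqrt_nonneg _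

theorem l2norm_sub_aux {n : ℕ} (y v : Fin n → ℝ) :
    l2norm (fun i => y i - v i) ^ 2 = (∑ i, y i ^ 2) - 2 * (∑ i, y i * v i) + l2norm v ^ 2 := by
  rw [l2norm_sq_aux, l2norm_sq_aux, Finset.mul_sum, ← Finset.sum_sub_distrib,
    ← Finset.sum_add_distrib]
  exact Finset.sum_congr rfl fun i _ => by ring

theorem l2norm_smul_aux {n : ℕ} (c : ℝ) (hc : 0 ≤ c) (v : Fin n → ℝ) :
    l2norm (fun i => c * v i) = c * l2norm v := by
  unfold l2norm
  simp only [mul_pow]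
  rw [← Finset.mul_sum, Real.sqrt_mul (sq_nonneg c), Real.sqrt_sq hc]

open Classical in
theorem stmt0 {T : ℕ} (y : Fin T → ℝ) (lam : ℝ) (hlam : 0 ≤ lam)
    (βhat : Fin T → ℝ)
    (hdef : βhat = if vecPosPart y = 0 then 0
      else fun i => max (1 - lam / l2norm (vecPosPart y)) 0 * vecPosPart y i) :
    (∀ i, 0 ≤ βhat i) ∧
    ∀ β : Fin T → ℝ, (∀ i, 0 ≤ β i) →
      1 / 2 * l2norm (fun i => y i - βhat i) ^ 2 + lam * l2norm βhat ≤
        1 / 2 * l2norm (fun i => y i - β i) ^ 2 + lam * l2norm β := by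
  have hp0 : ∀ i, 0 ≤ vecPosPart y i := fun i => le_max_right _ _
  have hyp : ∀ i, y i ≤ vecPosPart y i := fun i => le_max_left _ _
  have hyp2 : ∀ i, y i * vecPosPart y i = vecPosPart y i ^ 2 := by
    intro i
    unfold vecPosPart
    rcases le_total (y i) 0 with h | h
    · simp [max_eq_right h]
    · simp [max_eq_left h, sq]
  have key : ∃ c : ℝ, 0 ≤ c ∧ (βhat = fun i => c * vecPosPart y i) ∧
      c * l2norm (vecPosPart y) = max (l2norm (vecPosPart y) - lam) 0 := by
    by_cases h : vecPosPart y = 0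
    · refine ⟨0, le_rfl, ?_, ?_⟩
      · rw [hdef, if_pos h]; funext i; simp
      · rw [h]
        simp [l2norm, hlam]
    · refine ⟨_, le_max_right _ _, by rw [hdef, if_neg h], ?_⟩
      have hN : 0 < l2norm (vecPosPart y) := by
        refine lt_of_le_of_ne (l2norm_nonneg_aux _) fun h0 => h ?_
        have h1 := l2norm_sq_aux (vecPosPart y)
        rw [← h0] at h1
        have h2 := (Finset.sum_eq_zero_iff_of_nonneg
          (fun i _ => sq_nonneg (vecPosPart y i))).1 (by rw [← h1]; norm_num)
        funext i
        simpa using h2 i (Finset.mem_univ i)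
      rw [max_mul_of_nonneg _ _ hN.le, zero_mul, sub_mul, one_mul, div_mul_cancel₀ _ hN.ne']
  obtain ⟨c, hc, rfl, hm⟩ := key
  refine ⟨fun i => mul_nonneg hc (hp0 i), fun β hβ => ?_⟩
  rw [l2norm_sub_aux, l2norm_sub_aux, l2norm_smul_aux c hc]
  have e1 : ∑ i, y i * (c * vecPosPart y i) = c * l2norm (vecPosPart y) ^ 2 := by
    rw [l2norm_sq_aux, Finset.mul_sum]
    exact Finset.sum_congr rfl fun i _ => by rw [← hyp2]; ring
  have e2 : ∑ i, y i * β i ≤ l2norm (vecPosPart y) * l2norm β :=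
    (Finset.sum_le_sum fun i _ => mul_le_mul_of_nonneg_right (hyp i) (hβ i)).trans
      (Real.sum_mul_le_sqrt_mul_sqrt _ _ _)
  rw [e1]
  have hb := l2norm_nonneg_aux β
  generalize l2norm (vecPosPart y) = N at *
  generalize l2norm β = b at *
  have e3 : c * N ^ 2 = (c * N) * N := by ring
  rw [e3, hm]
  rcases le_total (N - lam) 0 with h | h
  · rw [max_eq_right h]
    nlinarith [mul_nonneg (sub_nonneg.2 h) hb, sq_nonneg b]
  · rw [max_eq_left h]
    nlinarith [sq_nonneg (N - lam - b)]
end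

section
/- Let Y ∈ ℝ^{P×T}, let ã ∈ ℝ^P be a nonzero vector, let λ ≥ 0 and α ∈ [0,1], and let 1 ∈ ℝ^T denote the all-ones vector. Define ẑ ∈ ℝ^T by ẑ = (1 − λ(1−α)/‖(Yᵀã − λα·1)₊‖₂)₊ · ((Yᵀã − λα·1)/(ãᵀã))₊ when (Yᵀã − λα·1)₊ ≠ 0, and ẑ = 0 when (Yᵀã − λα·1)₊ = 0. Then ẑ is entrywise nonnegative and minimizes (1/2)‖Y − ã zᵀ‖_F² + λα‖z‖₁ + λ(1−α)‖z‖₂ over all entrywise-nonnegative z ∈ ℝ^T. -/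
/-- The ℓ1 norm of a vector in ℝ^T. -/
def l1norm {n : ℕ} (v : Fin n → ℝ) : ℝ := ∑ i, |v i|

/-- The squared Frobenius norm of a P × T matrix. -/
def frobSq {P T : ℕ} (M : Fin P → Fin T → ℝ) : ℝ := ∑ p, ∑ t, (M p t) ^ 2

lemma aux_obj {P T : ℕ} (Y : Fin P → Fin T → ℝ) (a : Fin P → ℝ) (k : ℝ) (z : Fin T → ℝ)
    (hz : ∀ t, 0 ≤ z t) :
    1 / 2 * frobSq (fun p t => Y p t - a p * z t) + k * l1norm z =
      1 / 2 * frobSq Y + (∑ p, a p ^ 2) / 2 * l2norm z ^ 2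
        - ∑ t, ((∑ p, Y p t * a p) - k) * z t := by
  have h2 : l2norm z ^ 2 = ∑ t, z t ^ 2 := by
    unfold l2norm
    exact Real.sq_sqrt (Finset.sum_nonneg fun i _ => sq_nonneg _)
  have h1 : l1norm z = ∑ t, z t := by
    unfold l1norm
    exact Finset.sum_congr rfl fun t _ => abs_of_nonneg (hz t)
  have hf : frobSq (fun p t => Y p t - a p * z t) = frobSq Y
      - 2 * ∑ t, (∑ p, Y p t * a p) * z t + (∑ p, a p ^ 2) * ∑ t, z t ^ 2 := by
    unfold frobSq
    have e1 : ∑ t, (∑ p, Y p t * a p) * z t = ∑ p, ∑ t, Y p t * a p * z t := by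
      rw [Finset.sum_comm]
      exact Finset.sum_congr rfl fun t _ => Finset.sum_mul _ _ _
    rw [e1, Finset.sum_mul_sum, Finset.mul_sum, ← Finset.sum_sub_distrib,
      ← Finset.sum_add_distrib]
    refine Finset.sum_congr rfl fun p _ => ?_
    rw [Finset.mul_sum, ← Finset.sum_sub_distrib, ← Finset.sum_add_distrib]
    exact Finset.sum_congr rfl fun t _ => by ring
  have hs : ∑ t, ((∑ p, Y p t * a p) - k) * z t =
      ∑ t, (∑ p, Y p t * a p) * z t - k * ∑ t, z t := by
    rw [Finset.mul_sum, ← Finset.sum_sub_distrib]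
    exact Finset.sum_congr rfl fun t _ => by ring
  rw [hf, h1, h2, hs]
  ring

open Classical in
theorem stmt2 {P T : ℕ} (Y : Fin P → Fin T → ℝ) (a : Fin P → ℝ) (ha : a ≠ 0)
    (lam α : ℝ) (hlam : 0 ≤ lam) (hα0 : 0 ≤ α) (hα1 : α ≤ 1)
    (zhat : Fin T → ℝ)
    (hdef : zhat =
      if vecPosPart (fun t => (∑ p, Y p t * a p) - lam * α) = 0 then 0
      else fun t =>
        max (1 - lam * (1 - α) /
            l2norm (vecPosPart (fun t' => (∑ p, Y p t' * a p) - lam * α))) 0 *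
          max (((∑ p, Y p t * a p) - lam * α) / (∑ p, a p ^ 2)) 0) :
    (∀ t, 0 ≤ zhat t) ∧
    ∀ z : Fin T → ℝ, (∀ t, 0 ≤ z t) →
      1 / 2 * frobSq (fun p t => Y p t - a p * zhat t) + lam * α * l1norm zhat
          + lam * (1 - α) * l2norm zhat ≤
        1 / 2 * frobSq (fun p t => Y p t - a p * z t) + lam * α * l1norm z
          + lam * (1 - α) * l2norm z := by
  have hs : 0 < ∑ p, a p ^ 2 := by
    obtain ⟨p, hp⟩ := Function.ne_iff.mp ha
    have hp' : a p ≠ 0 := hp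
    exact Finset.sum_pos' (fun i _ => sq_nonneg _) ⟨p, Finset.mem_univ _, by positivity⟩
  have hmu : 0 ≤ lam * (1 - α) := mul_nonneg hlam (by linarith)
  have hobj := fun z hz => aux_obj Y a (lam * α) z hz
  generalize (∑ p, a p ^ 2) = s at *
  generalize lam * (1 - α) = mu at *
  generalize hw : (fun t => (∑ p, Y p t * a p) - lam * α) = w at *
  have hw' : ∀ t, (∑ p, Y p t * a p) - lam * α = w t := fun t => by rw [← hw]
  simp only [hw'] at hdef hobj
  have hN0 : 0 ≤ l2norm (vecPosPart w) := Real.sqrt_nonneg _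
  have hNsq : l2norm (vecPosPart w) ^ 2 = ∑ t, vecPosPart w t ^ 2 :=
    Real.sq_sqrt (Finset.sum_nonneg fun i _ => sq_nonneg _)
  have key : ∃ c : ℝ, 0 ≤ c ∧ (∀ t, zhat t = c / s * vecPosPart w t) ∧
      c * l2norm (vecPosPart w) = max (l2norm (vecPosPart w) - mu) 0 := by
    by_cases hu : vecPosPart w = 0
    · refine ⟨0, le_rfl, fun t => ?_, ?_⟩
      · rw [hdef, if_pos hu]; simp
      · have : l2norm (vecPosPart w) = 0 := by rw [hu]; simp [l2norm]
        rw [this, max_eq_right (by linarith)]; simp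
    · refine ⟨max (1 - mu / l2norm (vecPosPart w)) 0, le_max_right _ _, fun t => ?_, ?_⟩
      · rw [hdef, if_neg hu]
        have : max (w t / s) 0 = max (w t) 0 / s := by
          rw [← max_div_div_right hs.le, zero_div]
        simp only [this, vecPosPart]
        ring
      · have hN : 0 < l2norm (vecPosPart w) := by
          obtain ⟨t, ht⟩ := Function.ne_iff.mp hu
          have ht' : vecPosPart w t ≠ 0 := ht
          exact Real.sqrt_pos.mpr (Finset.sum_pos' (fun i _ => sq_nonneg _)
            ⟨t, Finset.mem_univ _, by positivity⟩)
        rw [max_mul_of_nonneg _ _ hN0, zero_mul, sub_mul, one_mul, div_mul_cancel₀ _ hN.ne']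
  obtain ⟨c, hc, hzh, hcN⟩ := key
  have hu0 : ∀ t, 0 ≤ vecPosPart w t := fun t => le_max_right _ _
  have hzh0 : ∀ t, 0 ≤ zhat t := fun t => by
    rw [hzh]; exact mul_nonneg (div_nonneg hc hs.le) (hu0 t)
  refine ⟨hzh0, fun z hz => ?_⟩
  rw [hobj z hz, hobj zhat hzh0]
  have hr0 : 0 ≤ l2norm z := Real.sqrt_nonneg _
  have hcs : ∑ t, w t * z t ≤ l2norm (vecPosPart w) * l2norm z := by
    refine le_trans (Finset.sum_le_sum fun t _ =>
      mul_le_mul_of_nonneg_right (le_max_left (w t) 0) (hz t)) ?_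
    exact Real.sum_mul_le_sqrt_mul_sqrt _ (vecPosPart w) z
  have hin : ∑ t, w t * zhat t = c / s * l2norm (vecPosPart w) ^ 2 := by
    rw [hNsq, Finset.mul_sum]
    refine Finset.sum_congr rfl fun t _ => ?_
    rw [hzh]
    have : w t * vecPosPart w t = vecPosPart w t ^ 2 := by
      unfold vecPosPart
      rcases le_total (w t) 0 with h | h
      · simp [max_eq_right h]
      · simp [max_eq_left h, sq]
    rw [← this]; ring
  have hzn : l2norm zhat = c / s * l2norm (vecPosPart w) := by
    have h0 : 0 ≤ c / s := div_nonneg hc hs.le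
    have : ∑ t, zhat t ^ 2 = (c / s * l2norm (vecPosPart w)) ^ 2 := by
      rw [mul_pow, hNsq, Finset.mul_sum]
      exact Finset.sum_congr rfl fun t _ => by rw [hzh]; ring
    unfold l2norm at this ⊢
    rw [this]
    exact Real.sqrt_sq (mul_nonneg h0 hN0)
  rw [hin, hzn]
  generalize l2norm (vecPosPart w) = N at *
  generalize l2norm z = r at *
  have hL : s / 2 * (c / s * N) ^ 2 - c / s * N ^ 2 + mu * (c / s * N)
      = ((c * N) ^ 2 / 2 - (c * N) * (N - mu)) / s := by
    field_simp; ring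
  have hR : ((c * N) ^ 2 / 2 - (c * N) * (N - mu)) / s ≤ s / 2 * r ^ 2 - (N - mu) * r := by
    rw [div_le_iff₀ hs, hcN]
    rcases le_total (N - mu) 0 with h | h
    · rw [max_eq_right h]
      have h1 := mul_nonneg hr0 (neg_nonneg.mpr h)
      have h2 := mul_nonneg h1 hs.le
      nlinarith [sq_nonneg (s * r)]
    · rw [max_eq_left h]
      nlinarith [sq_nonneg (s * r - (N - mu))]
  linarith
end

section
/- Let Y ∈ ℝ^{P×T}, Ã ∈ ℝ^{P×K}, λ ≥ 0, α ∈ [0,1]. Let N₁, …, N_S be a partition of the column index set {1, …, K}, and for each s define M(N_s) = {p ∈ {1, …, P} : Ã_{p,k} ≠ 0 for some k ∈ N_s}. Assume M(N_s) ∩ M(N_{s'}) = ∅ whenever s ≠ s'. Then an entrywise-nonnegative Z ∈ ℝ^{K×T} minimizes the sparse group lasso objective F(Z) = (1/2)‖Y − ÃZ‖_F² + λα Σ_{k=1}^K ‖z_{k,·}‖₁ + λ(1−α) Σ_{k=1}^K ‖z_{k,·}‖₂ over all entrywise-nonnegative matrices if and only if, for every s ∈ {1, …, S}, the row-submatrix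 Z_{N_s,·} minimizes F_s(W) = (1/2)‖Y_{M(N_s),·} − Ã_{M(N_s),N_s} W‖_F² + λα Σ_{n∈N_s} ‖w_{n,·}‖₁ + λ(1−α) Σ_{n∈N_s} ‖w_{n,·}‖₂ over all entrywise-nonnegative W ∈ ℝ^{|N_s|×T}. -/
/-- The sparse group lasso objective
  F(Z) = (1/2)‖Y − ÃZ‖_F² + λα Σ_k ‖z_k‖₁ + λ(1−α) Σ_k ‖z_k‖₂. -/
noncomputable def sglObj {P T K : ℕ} (Y : Fin P → Fin T → ℝ) (A : Fin P → Fin K → ℝ)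
    (lam α : ℝ) (Z : Fin K → Fin T → ℝ) : ℝ :=
  1 / 2 * (∑ p, ∑ t, (Y p t - ∑ k, A p k * Z k t) ^ 2)
    + lam * α * ∑ k, l1norm (Z k) + lam * (1 - α) * ∑ k, l2norm (Z k)

/-- The sparse group lasso objective restricted to the rows of pixels in `Ms` and the
  dictionary elements in `Ns`:
  F_s(W) = (1/2)‖Y_{M(N_s),·} − Ã_{M(N_s),N_s} W‖_F² + λα Σ_{n∈N_s} ‖w_n‖₁
    + λ(1−α) Σ_{n∈N_s} ‖w_n‖₂. -/
noncomputable def sglObjSub {P T K : ℕ} (Y : Fin P → Fin T → ℝ) (A : Fin P → Fin K → ℝ)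
    (lam α : ℝ) (Ns : Finset (Fin K)) (Ms : Finset (Fin P))
    (W : {k // k ∈ Ns} → Fin T → ℝ) : ℝ :=
  1 / 2 * (∑ p : Ms, ∑ t, (Y p.1 t - ∑ k : Ns, A p.1 k.1 * W k t) ^ 2)
    + lam * α * ∑ k : Ns, l1norm (W k) + lam * (1 - α) * ∑ k : Ns, l2norm (W k)

open Classical in
lemma sgl_decomp {P T K S : ℕ} (Y : Fin P → Fin T → ℝ) (A : Fin P → Fin K → ℝ)
    (lam α : ℝ)
    (N : Fin S → Finset (Fin K))
    (hNdisj : ∀ s s', s ≠ s' → Disjoint (N s) (N s'))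
    (hNcover : ∀ k, ∃ s, k ∈ N s)
    (M : Fin S → Finset (Fin P))
    (hM : ∀ s, M s = Finset.univ.filter (fun p => ∃ k ∈ N s, A p k ≠ 0))
    (hMdisj : ∀ s s', s ≠ s' → Disjoint (M s) (M s'))
    (W : Fin K → Fin T → ℝ) :
    sglObj Y A lam α W = (∑ s, sglObjSub Y A lam α (N s) (M s) (fun k => W k.1))
      + 1 / 2 * ∑ p ∈ Finset.univ \ Finset.univ.biUnion M, ∑ t, (Y p t) ^ 2 := by
  have hK : ∀ f : Fin K → ℝ, ∑ k, f k = ∑ s, ∑ k : {k // k ∈ N s}, f k.1 := by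
    intro f
    have hu : (Finset.univ : Finset (Fin K)) = Finset.univ.biUnion N := by
      ext k
      simpa using hNcover k
    rw [hu, Finset.sum_biUnion (fun s _ s' _ h => hNdisj s s' h)]
    exact Finset.sum_congr rfl fun s _ => (Finset.sum_coe_sort (N s) f).symm
  have hzero : ∀ p k, (∃ s, p ∈ M s ∧ k ∉ N s) → A p k = 0 := by
    rintro p k ⟨s, hp, hk⟩
    by_contra hne
    obtain ⟨s', hs'⟩ := hNcover k
    have hss : s ≠ s' := by
      rintro rfl
      exact hk hs'
    have hp' : p ∈ M s' := by
      rw [hM]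
      simp only [Finset.mem_filter, Finset.mem_univ, true_and]
      exact ⟨k, hs', hne⟩
    exact Finset.disjoint_left.mp (hMdisj s s' hss) hp hp'
  have hzero' : ∀ p k, p ∉ Finset.univ.biUnion M → A p k = 0 := by
    intro p k hp
    by_contra hne
    obtain ⟨s, hs⟩ := hNcover k
    apply hp
    simp only [Finset.mem_biUnion, Finset.mem_univ, true_and]
    refine ⟨s, ?_⟩
    rw [hM]
    simp only [Finset.mem_filter, Finset.mem_univ, true_and]
    exact ⟨k, hs, hne⟩
  have hP : (∑ p, ∑ t, (Y p t - ∑ k, A p k * W k t) ^ 2)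
      = (∑ s, ∑ p : {p // p ∈ M s}, ∑ t,
          (Y p.1 t - ∑ k : {k // k ∈ N s}, A p.1 k.1 * W k.1 t) ^ 2)
        + ∑ p ∈ Finset.univ \ Finset.univ.biUnion M, ∑ t, (Y p t) ^ 2 := by
    rw [← Finset.sum_sdiff (Finset.subset_univ (Finset.univ.biUnion M)), add_comm]
    congr 1
    · rw [Finset.sum_biUnion (fun s _ s' _ h => hMdisj s s' h)]
      refine Finset.sum_congr rfl fun s _ => ?_
      rw [← Finset.sum_coe_sort (M s)]
      refine Finset.sum_congr rfl fun p _ => Finset.sum_congr rfl fun t _ => ?_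
      rw [Finset.sum_coe_sort (N s) (fun k => A p.1 k * W k t)]
      rw [Finset.sum_subset (Finset.subset_univ (N s))]
      intro k _ hk
      rw [hzero p.1 k ⟨s, p.2, hk⟩, zero_mul]
    · refine Finset.sum_congr rfl fun p hp => Finset.sum_congr rfl fun t _ => ?_
      have hp' := (Finset.mem_sdiff.mp hp).2
      simp [hzero' p _ hp']
  unfold sglObj sglObjSub
  rw [hP, hK (fun k => l1norm (W k)), hK (fun k => l2norm (W k))]
  simp only [Finset.sum_add_distrib, ← Finset.mul_sum]
  ring

open Classical in
theorem stmt4 {P T K S : ℕ} (Y : Fin P → Fin T → ℝ) (A : Fin P → Fin K → ℝ)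
    (lam α : ℝ) (hlam : 0 ≤ lam) (hα0 : 0 ≤ α) (hα1 : α ≤ 1)
    (N : Fin S → Finset (Fin K))
    (hNdisj : ∀ s s', s ≠ s' → Disjoint (N s) (N s'))
    (hNcover : ∀ k, ∃ s, k ∈ N s)
    (M : Fin S → Finset (Fin P))
    (hM : ∀ s, M s = Finset.univ.filter (fun p => ∃ k ∈ N s, A p k ≠ 0))
    (hMdisj : ∀ s s', s ≠ s' → Disjoint (M s) (M s'))
    (Z : Fin K → Fin T → ℝ) (hZ : ∀ k t, 0 ≤ Z k t) :
    (∀ W : Fin K → Fin T → ℝ, (∀ k t, 0 ≤ W k t) →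
        sglObj Y A lam α Z ≤ sglObj Y A lam α W)
      ↔
    ∀ s : Fin S, ∀ W : {k // k ∈ N s} → Fin T → ℝ, (∀ k t, 0 ≤ W k t) →
        sglObjSub Y A lam α (N s) (M s) (fun k => Z k.1) ≤
          sglObjSub Y A lam α (N s) (M s) W := by
  have hd := sgl_decomp Y A lam α N hNdisj hNcover M hM hMdisj
  constructor
  · intro h s W hW
    let W' : Fin K → Fin T → ℝ := fun k => if hk : k ∈ N s then W ⟨k, hk⟩ else Z k
    have hW' : ∀ k t, 0 ≤ W' k t := by
      intro k t
      by_cases hk : k ∈ N s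
      · simpa [W', hk] using hW ⟨k, hk⟩ t
      · simpa [W', hk] using hZ k t
    have h1 := h W' hW'
    rw [hd Z, hd W'] at h1
    have h2 := le_of_add_le_add_right h1
    rw [← Finset.add_sum_erase _ _ (Finset.mem_univ s),
      ← Finset.add_sum_erase _ _ (Finset.mem_univ s)] at h2
    have e1 : (fun k : {k // k ∈ N s} => W' k.1) = W := by
      funext k
      simp [W']
    have e2 : ∀ s' ∈ Finset.univ.erase s,
        sglObjSub Y A lam α (N s') (M s') (fun k => W' k.1)
          = sglObjSub Y A lam α (N s') (M s') (fun k => Z k.1) := by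
      intro s' hs'
      congr 1
      funext k
      have hk : k.1 ∉ N s :=
        Finset.disjoint_left.mp (hNdisj s' s (Finset.ne_of_mem_erase hs')) k.2
      simp [W', hk]
    rw [Finset.sum_congr rfl e2, e1] at h2
    exact le_of_add_le_add_right h2
  · intro h W hW
    rw [hd Z, hd W]
    gcongr with s _
    exact h s _ fun k t => hW k.1 t
end

section
/- Let Y ∈ ℝ^{P×T} and Ã ∈ ℝ^{P×K}. Let N₁, …, N_S be a partition of {1, …, K}, and for each s define M(N_s) = {p ∈ {1, …, P} : Ã_{p,k} ≠ 0 for some k ∈ N_s}; assume M(N_s) ∩ M(N_{s'}) = ∅ whenever s ≠ s'. Let R = {1, …, P} \ (M(N₁) ∪ ⋯ ∪ M(N_S)). Then for every Z ∈ ℝ^{K×T}, ‖Y − ÃZ‖_F² = Σ_{s=1}^S ‖Y_{M(N_s),·} − Ã_{M(N_s),N_s} Z_{N_s,·}‖_F² + ‖Y_{R,·}‖_F². -/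
open Classical in
theorem stmt5 {P T K S : ℕ} (Y : Fin P → Fin T → ℝ) (A : Fin P → Fin K → ℝ)
    (N : Fin S → Finset (Fin K))
    (hNdisj : ∀ s s', s ≠ s' → Disjoint (N s) (N s'))
    (hNcover : ∀ k, ∃ s, k ∈ N s)
    (M : Fin S → Finset (Fin P))
    (hM : ∀ s, M s = Finset.univ.filter (fun p => ∃ k ∈ N s, A p k ≠ 0))
    (hMdisj : ∀ s s', s ≠ s' → Disjoint (M s) (M s'))
    (R : Finset (Fin P))
    (hR : R = Finset.univ \ Finset.univ.biUnion (fun s => M s)) :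
    ∀ Z : Fin K → Fin T → ℝ,
      (∑ p, ∑ t, (Y p t - ∑ k, A p k * Z k t) ^ 2) =
        (∑ s, ∑ p : M s, ∑ t, (Y p.1 t - ∑ k : N s, A p.1 k.1 * Z k.1 t) ^ 2)
          + ∑ p : R, ∑ t, (Y p.1 t) ^ 2 := by
  intro Z
  have hA : ∀ s p k, k ∈ N s → p ∉ M s → A p k = 0 := by
    intro s p k hk hp
    by_contra h
    apply hp
    rw [hM]
    exact Finset.mem_filter.2 ⟨Finset.mem_univ _, k, hk, h⟩
  have h1 : ∀ s, (∑ p : M s, ∑ t, (Y p.1 t - ∑ k : N s, A p.1 k.1 * Z k.1 t) ^ 2)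
      = ∑ p ∈ M s, ∑ t, (Y p t - ∑ k, A p k * Z k t) ^ 2 := by
    intro s
    rw [← Finset.sum_coe_sort (M s)]
    refine Finset.sum_congr rfl fun p _ => Finset.sum_congr rfl fun t _ => ?_
    rw [Finset.sum_coe_sort (N s) (fun k => A p.1 k * Z k t)]
    rw [Finset.sum_subset (Finset.subset_univ (N s))]
    intro k _ hk
    obtain ⟨s', hs'⟩ := hNcover k
    have hne : s ≠ s' := by
      rintro rfl
      exact hk hs'
    rw [hA s' p.1 k hs' (Finset.disjoint_left.1 (hMdisj s s' hne) p.2), zero_mul]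
  have h2 : (∑ p : R, ∑ t, (Y p.1 t) ^ 2)
      = ∑ p ∈ R, ∑ t, (Y p t - ∑ k, A p k * Z k t) ^ 2 := by
    rw [← Finset.sum_coe_sort R]
    refine Finset.sum_congr rfl fun p _ => Finset.sum_congr rfl fun t _ => ?_
    rw [Finset.sum_eq_zero, sub_zero]
    intro k _
    obtain ⟨s, hs⟩ := hNcover k
    have hp := Finset.mem_sdiff.1 (hR.le p.2)
    rw [hA s p.1 k hs (fun h => hp.2 (Finset.mem_biUnion.2 ⟨s, Finset.mem_univ _, h⟩)), zero_mul]
  rw [h2, Finset.sum_congr rfl fun s _ => h1 s, ← Finset.sum_biUnion, hR, add_comm,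
    Finset.sum_sdiff (Finset.subset_univ _)]
  intro s _ s' _ h
  exact hMdisj s s' h
end

section
/- Let A ∈ ℝ^{P×K} be a matrix with all entries in {0,1} and all columns a₁, …, a_K nonzero, satisfying a₁ᵀa₂ = 0, a₁ᵀa_k = 0 for all k ∈ {3, …, K}, and a₂ᵀa_k = 0 for all k ∈ {3, …, K}. Let Z* ∈ ℝ^{K×T} be such that its first row satisfies z*_{1,·} = P z*_{2,·} for some T×T permutation matrix P, and set Y = A Z*. Define Ã ∈ ℝ^{P×K} with columns ã_k = a_k / ‖a_k‖₂². Let λ ≥ 0 and α ∈ [0,1], and let Ẑ be any minimizer over entrywise-nonnegative Z ∈ ℝ^{K×T} of the sparse group lasso objective F(Z) = (1/2)‖Y − ÃZ‖_F² + λα Σ_{k=1}^K ‖z_{k,·}‖₁ + λ(1−α) Σ_{k=1}^K ‖z_{k,·}‖₂. Then the first row of Ẑ is the zero vector if and only if the second row of Ẑ is the zero vector. -/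
theorem l2norm_smul' {T : ℕ} (s : ℝ) (hs : 0 ≤ s) (w : Fin T → ℝ) :
    l2norm (fun t => s * w t) = s * l2norm w := by
  unfold l2norm
  simp_rw [mul_pow]
  rw [← Finset.mul_sum, Real.sqrt_mul (sq_nonneg s), Real.sqrt_sq hs]

theorem l1norm_smul' {T : ℕ} (s : ℝ) (hs : 0 ≤ s) (w : Fin T → ℝ) :
    l1norm (fun t => s * w t) = s * l1norm w := by
  unfold l1norm
  simp_rw [abs_mul, abs_of_nonneg hs]
  rw [← Finset.mul_sum]

theorem obj_update {P T K : ℕ} (Y : Fin P → Fin T → ℝ) (B : Fin P → Fin K → ℝ)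
    (lam α : ℝ) (Z : Fin K → Fin T → ℝ) (i : Fin K) (zs : Fin T → ℝ)
    (horth : ∀ k, k ≠ i → ∑ p, B p i * B p k = 0)
    (hzs : ∀ t, ∑ p, B p i * Y p t = zs t) (w : Fin T → ℝ) :
    sglObj Y B lam α (Function.update Z i w) = sglObj Y B lam α (Function.update Z i 0)
      + 1 / 2 * (∑ p, B p i ^ 2) * (∑ t, w t ^ 2) - ∑ t, zs t * w t
      + lam * α * l1norm w + lam * (1 - α) * l2norm w := by
  set Z0 := Function.update Z i 0 with hZ0
  have h1 : ∀ p t, ∑ k, B p k * Function.update Z i w k t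
      = (∑ k, B p k * Z0 k t) + B p i * w t := by
    intro p t
    rw [← Finset.add_sum_erase _ _ (Finset.mem_univ i),
      ← Finset.add_sum_erase _ (fun k => B p k * Z0 k t) (Finset.mem_univ i)]
    have : ∑ x ∈ Finset.univ.erase i, B p x * Function.update Z i w x t
        = ∑ x ∈ Finset.univ.erase i, B p x * Z0 x t := by
      apply Finset.sum_congr rfl
      intro x hx
      have hx' := Finset.ne_of_mem_erase hx
      simp [hZ0, Function.update_of_ne hx']
    rw [this]
    simp [hZ0]
    ring
  have h2 : ∀ f : (Fin T → ℝ) → ℝ, f 0 = 0 →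
      ∑ k, f (Function.update Z i w k) = (∑ k, f (Z0 k)) + f w := by
    intro f hf
    rw [← Finset.add_sum_erase _ _ (Finset.mem_univ i),
      ← Finset.add_sum_erase _ (fun k => f (Z0 k)) (Finset.mem_univ i)]
    have : ∑ x ∈ Finset.univ.erase i, f (Function.update Z i w x)
        = ∑ x ∈ Finset.univ.erase i, f (Z0 x) := by
      apply Finset.sum_congr rfl
      intro x hx
      have hx' := Finset.ne_of_mem_erase hx
      simp [hZ0, Function.update_of_ne hx']
    rw [this]
    simp [hZ0, hf]
    ring
  have hR : ∀ t, ∑ p, B p i * (Y p t - ∑ k, B p k * Z0 k t) = zs t := by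
    intro t
    simp_rw [mul_sub]
    rw [Finset.sum_sub_distrib, hzs]
    simp_rw [Finset.mul_sum]
    rw [Finset.sum_comm]
    rw [Finset.sum_eq_zero, sub_zero]
    intro k _
    by_cases hk : k = i
    · subst hk; simp [hZ0]
    · simp_rw [← mul_assoc]
      rw [← Finset.sum_mul, horth k hk, zero_mul]
  have h3 : ∑ p, ∑ t, (Y p t - ∑ k, B p k * Function.update Z i w k t) ^ 2
      = ∑ p, ∑ t, (Y p t - ∑ k, B p k * Z0 k t) ^ 2 - 2 * ∑ t, zs t * w t
        + (∑ p, B p i ^ 2) * ∑ t, w t ^ 2 := by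
    rw [Finset.sum_comm, Finset.sum_comm (f := fun p t => (Y p t - ∑ k, B p k * Z0 k t) ^ 2),
      Finset.mul_sum, Finset.mul_sum, ← Finset.sum_sub_distrib, ← Finset.sum_add_distrib]
    apply Finset.sum_congr rfl
    intro t _
    rw [← hR t, Finset.sum_mul, Finset.mul_sum, Finset.sum_mul, ← Finset.sum_sub_distrib,
      ← Finset.sum_add_distrib]
    apply Finset.sum_congr rfl
    intro p _
    rw [h1]
    ring
  unfold sglObj
  rw [h3, h2 l1norm (by simp [l1norm]), h2 l2norm (by simp [l2norm])]
  ring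

theorem row_zero_iff {P T K : ℕ} (Y : Fin P → Fin T → ℝ) (B : Fin P → Fin K → ℝ)
    (lam α : ℝ) (Z : Fin K → Fin T → ℝ) (i : Fin K) (zs : Fin T → ℝ)
    (horth : ∀ k, k ≠ i → ∑ p, B p i * B p k = 0)
    (hzs : ∀ t, ∑ p, B p i * Y p t = zs t)
    (hpos : 0 < ∑ p, B p i ^ 2) (hZ : ∀ k t, 0 ≤ Z k t)
    (hmin : ∀ W : Fin K → Fin T → ℝ, (∀ k t, 0 ≤ W k t) →
        sglObj Y B lam α Z ≤ sglObj Y B lam α W) :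
    (∀ t, Z i t = 0) ↔ ∀ w : Fin T → ℝ, (∀ t, 0 ≤ w t) →
      0 ≤ - ∑ t, zs t * w t + lam * α * l1norm w + lam * (1 - α) * l2norm w := by
  have hup : ∀ w : Fin T → ℝ, (∀ t, 0 ≤ w t) → ∀ k t, 0 ≤ Function.update Z i w k t := by
    intro w hw k t
    by_cases hk : k = i
    · subst hk; simpa using hw t
    · simpa [Function.update_of_ne hk] using hZ k t
  constructor
  · intro h0 w hw
    have hZi : Function.update Z i 0 = Z := by
      rw [Function.update_eq_self_iff]; funext t; exact (h0 t).symm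
    set H := - ∑ t, zs t * w t + lam * α * l1norm w + lam * (1 - α) * l2norm w with hH
    set C := 1 / 2 * (∑ p, B p i ^ 2) * (∑ t, w t ^ 2) with hC
    have hC0 : 0 ≤ C := by positivity
    have key : ∀ s : ℝ, 0 < s → 0 ≤ s * C + H := by
      intro s hs
      have h := hmin _ (hup (fun t => s * w t) (fun t => mul_nonneg hs.le (hw t)))
      rw [obj_update Y B lam α Z i zs horth hzs, hZi, l1norm_smul' s hs.le,
        l2norm_smul' s hs.le] at h
      have e1 : ∑ t, (s * w t) ^ 2 = s ^ 2 * ∑ t, w t ^ 2 := by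
        rw [Finset.mul_sum]; exact Finset.sum_congr rfl (fun t _ => by ring)
      have e2 : ∑ t, zs t * (s * w t) = s * ∑ t, zs t * w t := by
        rw [Finset.mul_sum]; exact Finset.sum_congr rfl (fun t _ => by ring)
      rw [e1, e2] at h
      have : 0 ≤ s * (s * C + H) := by rw [hC, hH]; linarith
      exact nonneg_of_mul_nonneg_right this hs
    by_contra hneg
    push Not at hneg
    have hs : 0 < -H / (2 * (C + 1)) := by apply div_pos <;> linarith
    have := key _ hs
    have e : -H / (2 * (C + 1)) * C ≤ -H / 2 := by
      rw [div_mul_eq_mul_div, div_le_div_iff₀ (by linarith) (by norm_num)]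
      nlinarith
    linarith
  · intro h
    have h1 := hmin _ (hup 0 (fun _ => le_rfl))
    have h2 := obj_update Y B lam α Z i zs horth hzs (Z i)
    rw [Function.update_eq_self] at h2
    have h3 := h (Z i) (hZ i)
    have h4 : (∑ p, B p i ^ 2) * (∑ t, Z i t ^ 2) ≤ 0 := by linarith
    have h5 : ∑ t, Z i t ^ 2 ≤ 0 := by
      by_contra hc
      push Not at hc
      have := mul_pos hpos hc
      linarith
    have h6 : ∑ t, Z i t ^ 2 = 0 := le_antisymm h5 (Finset.sum_nonneg fun t _ => sq_nonneg _)
    intro t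
    have := (Finset.sum_eq_zero_iff_of_nonneg (fun t _ => sq_nonneg (Z i t))).1 h6 t
      (Finset.mem_univ t)
    exact pow_eq_zero_iff (two_ne_zero) |>.1 this

theorem stmt6 {P T K : ℕ} (A : Fin P → Fin K → ℝ)
    (h01 : ∀ p k, A p k = 0 ∨ A p k = 1)
    (hnz : ∀ k, (fun p => A p k) ≠ 0)
    (i1 i2 : Fin K) (hi1 : (i1 : ℕ) = 0) (hi2 : (i2 : ℕ) = 1)
    (horth12 : (∑ p, A p i1 * A p i2) = 0)
    (horth1 : ∀ k, k ≠ i1 → k ≠ i2 → (∑ p, A p i1 * A p k) = 0)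
    (horth2 : ∀ k, k ≠ i1 → k ≠ i2 → (∑ p, A p i2 * A p k) = 0)
    (Zstar : Fin K → Fin T → ℝ)
    (σ : Equiv.Perm (Fin T))
    (hperm : ∀ t, Zstar i1 t = Zstar i2 (σ t))
    (Y : Fin P → Fin T → ℝ)
    (hY : ∀ p t, Y p t = ∑ k, A p k * Zstar k t)
    (At : Fin P → Fin K → ℝ)
    (hAt : ∀ p k, At p k = A p k / (∑ q, A q k ^ 2))
    (lam α : ℝ) (hlam : 0 ≤ lam) (hα0 : 0 ≤ α) (hα1 : α ≤ 1)
    (Zhat : Fin K → Fin T → ℝ) (hZhatpos : ∀ k t, 0 ≤ Zhat k t)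
    (hmin : ∀ W : Fin K → Fin T → ℝ, (∀ k t, 0 ≤ W k t) →
        sglObj Y At lam α Zhat ≤ sglObj Y At lam α W) :
    (∀ t, Zhat i1 t = 0) ↔ (∀ t, Zhat i2 t = 0) := by
  have hne : i1 ≠ i2 := by
    intro h; rw [h] at hi1; omega
  have hn : ∀ k, 0 < ∑ q, A q k ^ 2 := by
    intro k
    obtain ⟨p, hp⟩ := Function.ne_iff.1 (hnz k)
    exact Finset.sum_pos' (fun _ _ => sq_nonneg _)
      ⟨p, Finset.mem_univ p, by have hp' : A p k ≠ 0 := hp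
                                positivity⟩
  have main : ∀ i, (∀ k, k ≠ i → ∑ p, A p i * A p k = 0) →
      ((∀ t, Zhat i t = 0) ↔ ∀ w : Fin T → ℝ, (∀ t, 0 ≤ w t) →
      0 ≤ - ∑ t, Zstar i t * w t + lam * α * l1norm w + lam * (1 - α) * l2norm w) := by
    intro i hi
    apply row_zero_iff Y At lam α Zhat i (Zstar i) _ _ _ hZhatpos hmin
    · intro k hk
      simp_rw [hAt, div_mul_div_comm]
      rw [← Finset.sum_div, hi k hk, zero_div]
    · intro t
      simp_rw [hAt, hY, div_mul_eq_mul_div]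
      rw [← Finset.sum_div, div_eq_iff (hn i).ne']
      simp_rw [Finset.mul_sum, ← mul_assoc]
      rw [Finset.sum_comm]
      simp_rw [← Finset.sum_mul]
      rw [Finset.sum_eq_single i]
      · rw [mul_comm, Finset.mul_sum]; exact Finset.sum_congr rfl (fun p _ => by ring)
      · intro k _ hk
        rw [hi k hk, zero_mul]
      · simp
    · simp_rw [hAt, div_pow]
      rw [← Finset.sum_div]
      have := hn i
      positivity
  rw [main i1, main i2]
  · have hl1 : ∀ (τ : Equiv.Perm (Fin T)) (w : Fin T → ℝ), l1norm (fun t => w (τ t)) = l1norm w :=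
      fun τ w => Equiv.sum_comp τ (fun t => |w t|)
    have hl2 : ∀ (τ : Equiv.Perm (Fin T)) (w : Fin T → ℝ), l2norm (fun t => w (τ t)) = l2norm w :=
      fun τ w => congrArg Real.sqrt (Equiv.sum_comp τ (fun t => w t ^ 2))
    constructor
    · intro h w hw
      have := h (fun t => w (σ t)) (fun t => hw _)
      rw [hl1, hl2] at this
      simp_rw [hperm] at this
      rwa [Equiv.sum_comp σ (fun t => Zstar i2 t * w t)] at this
    · intro h w hw
      have := h (fun t => w (σ.symm t)) (fun t => hw _)
      rw [hl1, hl2, ← Equiv.sum_comp σ] at this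
      simpa [hperm] using this
  · intro k hk
    by_cases h : k = i1
    · subst h; simpa [mul_comm] using horth12
    · exact horth2 k h hk
  · intro k hk
    by_cases h : k = i2
    · subst h; exact horth12
    · exact horth1 k hk h
end

section
/- Let Y ∈ ℝ^{P×T}, Ã ∈ ℝ^{P×K}, and α ∈ (0,1). If λ ∈ ℝ satisfies λ ≥ max_{k=1,…,K} [ min( max_{l=1,…,T} ((ÃᵀY)_{k,l})₊ / α , ‖((ÃᵀY)_{k,·})₊‖₂ / (1−α) ) ], then the zero matrix minimizes the sparse group lasso objective F(Z) = (1/2)‖Y − ÃZ‖_F² + λα Σ_{k=1}^K ‖z_{k,·}‖₁ + λ(1−α) Σ_{k=1}^K ‖z_{k,·}‖₂ over all entrywise-nonnegative Z ∈ ℝ^{K×T}. -/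
theorem row_aux {T : ℕ} (hT : 0 < T) (c z : Fin T → ℝ) (lam α : ℝ) (hα0 : 0 < α) (hα1 : α < 1)
    (hlam : min
        ((Finset.univ.sup' ⟨⟨0, hT⟩, Finset.mem_univ _⟩
            (fun l : Fin T => max (c l) 0)) / α)
        (l2norm (fun l => max (c l) 0) / (1 - α)) ≤ lam) (hz : ∀ t, 0 ≤ z t) :
    ∑ t, c t * z t ≤ lam * α * l1norm z + lam * (1 - α) * l2norm z := by
  have h1 : 0 < 1 - α := by linarith
  have hl1 : 0 ≤ l1norm z := Finset.sum_nonneg fun i _ => abs_nonneg _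
  have hl2 : 0 ≤ l2norm z := Real.sqrt_nonneg _
  have hle : ∑ t, c t * z t ≤ ∑ t, max (c t) 0 * z t :=
    Finset.sum_le_sum fun t _ => mul_le_mul_of_nonneg_right (le_max_left _ _) (hz t)
  rcases min_le_iff.1 hlam with h | h
  · rw [div_le_iff₀ hα0] at h
    have hb : ∀ t, max (c t) 0 ≤ lam * α := fun t =>
      (Finset.le_sup' (fun l : Fin T => max (c l) 0) (Finset.mem_univ t)).trans h
    have h0 : 0 ≤ lam * α := (le_max_right _ _).trans (hb ⟨0, hT⟩)
    have hl : 0 ≤ lam := nonneg_of_mul_nonneg_left h0 hα0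
    have : ∑ t, max (c t) 0 * z t ≤ lam * α * l1norm z := by
      unfold l1norm
      rw [Finset.mul_sum]
      refine Finset.sum_le_sum fun t _ => ?_
      rw [abs_of_nonneg (hz t)]
      exact mul_le_mul_of_nonneg_right (hb t) (hz t)
    have : 0 ≤ lam * (1 - α) * l2norm z := by positivity
    linarith
  · rw [div_le_iff₀ h1] at h
    have h0 : 0 ≤ lam * (1 - α) := (Real.sqrt_nonneg _).trans h
    have hl : 0 ≤ lam := nonneg_of_mul_nonneg_left h0 h1
    have h3 : ∑ t, max (c t) 0 * z t ≤ l2norm (fun l => max (c l) 0) * l2norm z :=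
      Real.sum_mul_le_sqrt_mul_sqrt _ _ _
    have h4 := mul_le_mul_of_nonneg_right h hl2
    have : 0 ≤ lam * α * l1norm z := by positivity
    linarith

theorem stmt8 {P T K : ℕ} (hT : 0 < T) (Y : Fin P → Fin T → ℝ) (A : Fin P → Fin K → ℝ)
    (lam α : ℝ) (hα0 : 0 < α) (hα1 : α < 1)
    (hlam : ∀ k : Fin K,
      min
        ((Finset.univ.sup' ⟨⟨0, hT⟩, Finset.mem_univ _⟩
            (fun l : Fin T => max (∑ p, A p k * Y p l) 0)) / α)
        (l2norm (fun l => max (∑ p, A p k * Y p l) 0) / (1 - α)) ≤ lam) :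
    ∀ Z : Fin K → Fin T → ℝ, (∀ k t, 0 ≤ Z k t) →
      sglObj Y A lam α 0 ≤ sglObj Y A lam α Z := by
  intro Z hZ
  have key := Finset.sum_le_sum fun k (_ : k ∈ (Finset.univ : Finset (Fin K))) =>
    row_aux hT (fun l => ∑ p, A p k * Y p l) (Z k) lam α hα0 hα1 (hlam k) (hZ k)
  rw [Finset.sum_add_distrib, ← Finset.mul_sum, ← Finset.mul_sum] at key
  have hsw : ∑ k, ∑ t, (∑ p, A p k * Y p t) * Z k t
      = ∑ p, ∑ t, Y p t * ∑ k, A p k * Z k t := by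
    simp only [Finset.sum_mul, Finset.mul_sum]
    calc _ = ∑ k, ∑ p, ∑ t, A p k * Y p t * Z k t :=
          Finset.sum_congr rfl fun k _ => Finset.sum_comm
      _ = ∑ p, ∑ k, ∑ t, A p k * Y p t * Z k t := Finset.sum_comm
      _ = ∑ p, ∑ t, ∑ k, A p k * Y p t * Z k t :=
          Finset.sum_congr rfl fun k _ => Finset.sum_comm
      _ = _ := Finset.sum_congr rfl fun p _ => Finset.sum_congr rfl fun t _ =>
          Finset.sum_congr rfl fun k _ => by ring
  have hq : 1 / 2 * (∑ p, ∑ t, Y p t ^ 2) - ∑ p, ∑ t, Y p t * ∑ k, A p k * Z k t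
      ≤ 1 / 2 * (∑ p, ∑ t, (Y p t - ∑ k, A p k * Z k t) ^ 2) := by
    simp only [Finset.mul_sum (f := fun p => ∑ t, _ ), Finset.mul_sum Finset.univ _ (1 / 2 : ℝ)]
    rw [← Finset.sum_sub_distrib]
    refine Finset.sum_le_sum fun p _ => ?_
    rw [← Finset.sum_sub_distrib]
    refine Finset.sum_le_sum fun t _ => ?_
    nlinarith [sq_nonneg (∑ k, A p k * Z k t)]
  have h0 : sglObj Y A lam α 0 = 1 / 2 * (∑ p, ∑ t, Y p t ^ 2) := by
    simp [sglObj, l1norm, l2norm]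
  rw [h0]
  unfold sglObj
  rw [hsw] at key
  linarith
end

section
/- Let K ≥ 3 and let A ∈ ℝ^{P×K} have all entries in {0,1} and all columns a₁, …, a_K nonzero, with a₃ = a₁ + a₂, a₁ᵀa₂ = 0, a₁ᵀa_k = 0 for all k ∈ {4, …, K}, and a₂ᵀa_k = 0 for all k ∈ {4, …, K}. Define Ã ∈ ℝ^{P×K} with columns ã_k = a_k / ‖a_k‖₂², let Y ∈ ℝ^{P×T}, λ ≥ 0, α ∈ [0,1], and let F(Z) = (1/2)‖Y − ÃZ‖_F² + λα Σ_{k=1}^K ‖z_{k,·}‖₁ + λ(1−α) Σ_{k=1}^K ‖z_{k,·}‖₂. For any entrywise-nonnegative Z ∈ ℝ^{K×T}, define Z̃ ∈ ℝ^{K×T} by z̃_{1,·} = z_{1,·} + (1ᵀa₁ / 1ᵀa₃)·z_{3,·}, z̃_{2,·} = z_{2,·} + (1ᵀa₂ / 1ᵀa₃)·z_{3,·}, z̃_{3,·} = 0, and z̃_{k,·} = z_{k,·} for k ∉ {1,2,3}. Then Z̃ is entrywise nonnegative, Ã Z̃ = Ã Z, and F(Z̃) ≤ F(Z). In particular, if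 Ẑ minimizes F over entrywise-nonnegative matrices, then the corresponding matrix Z̃ also minimizes F and has third row identically zero. -/
theorem l2norm_eq_norm {n : ℕ} (v : Fin n → ℝ) : l2norm v = ‖(WithLp.toLp 2 v : EuclideanSpace ℝ (Fin n))‖ := by
  rw [EuclideanSpace.norm_eq]
  simp [l2norm]

theorem l2norm_tri {n : ℕ} (x y : Fin n → ℝ) (c : ℝ) (hc : 0 ≤ c) :
    l2norm (fun t => x t + c * y t) ≤ l2norm x + c * l2norm y := by
  rw [l2norm_eq_norm, l2norm_eq_norm, l2norm_eq_norm]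
  have h : (WithLp.toLp 2 (fun t => x t + c * y t) : EuclideanSpace ℝ (Fin n))
      = WithLp.toLp 2 x + c • WithLp.toLp 2 y := by
    ext t; simp
  rw [h]
  refine (norm_add_le _ _).trans ?_
  rw [norm_smul, Real.norm_of_nonneg hc]

theorem l1norm_tri {n : ℕ} (x y : Fin n → ℝ) (c : ℝ) (hc : 0 ≤ c) :
    l1norm (fun t => x t + c * y t) ≤ l1norm x + c * l1norm y := by
  unfold l1norm
  rw [Finset.mul_sum, ← Finset.sum_add_distrib]
  refine Finset.sum_le_sum fun t _ => ?_
  refine (abs_add_le _ _).trans ?_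
  rw [abs_mul, abs_of_nonneg hc]

theorem split3 {K : ℕ} (i1 i2 i3 : Fin K) (h12 : i1 ≠ i2) (h13 : i1 ≠ i3) (h23 : i2 ≠ i3)
    (f : Fin K → ℝ) :
    ∑ k, f k = f i1 + f i2 + f i3 + ∑ k ∈ Finset.univ \ {i1, i2, i3}, f k := by
  rw [← Finset.sum_sdiff (Finset.subset_univ ({i1, i2, i3} : Finset (Fin K)))]
  rw [Finset.sum_insert (by simp [h12, h13]), Finset.sum_insert (by simp [h23]),
    Finset.sum_singleton]
  ring

theorem stmt9 {P T K : ℕ} (A : Fin P → Fin K → ℝ)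
    (h01 : ∀ p k, A p k = 0 ∨ A p k = 1)
    (hnz : ∀ k, (fun p => A p k) ≠ 0)
    (i1 i2 i3 : Fin K) (hi1 : (i1 : ℕ) = 0) (hi2 : (i2 : ℕ) = 1) (hi3 : (i3 : ℕ) = 2)
    (ha3 : ∀ p, A p i3 = A p i1 + A p i2)
    (horth12 : (∑ p, A p i1 * A p i2) = 0)
    (horth1 : ∀ k, k ≠ i1 → k ≠ i2 → k ≠ i3 → (∑ p, A p i1 * A p k) = 0)
    (horth2 : ∀ k, k ≠ i1 → k ≠ i2 → k ≠ i3 → (∑ p, A p i2 * A p k) = 0)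
    (At : Fin P → Fin K → ℝ)
    (hAt : ∀ p k, At p k = A p k / (∑ q, A q k ^ 2))
    (Y : Fin P → Fin T → ℝ)
    (lam α : ℝ) (hlam : 0 ≤ lam) (hα0 : 0 ≤ α) (hα1 : α ≤ 1)
    (Zt : (Fin K → Fin T → ℝ) → (Fin K → Fin T → ℝ))
    (hZt : ∀ Z k t, Zt Z k t =
      if k = i1 then Z i1 t + (∑ p, A p i1) / (∑ p, A p i3) * Z i3 t
      else if k = i2 then Z i2 t + (∑ p, A p i2) / (∑ p, A p i3) * Z i3 t
      else if k = i3 then 0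
      else Z k t) :
    (∀ Z : Fin K → Fin T → ℝ, (∀ k t, 0 ≤ Z k t) →
      (∀ k t, 0 ≤ Zt Z k t) ∧
      (∀ p t, (∑ k, At p k * Zt Z k t) = ∑ k, At p k * Z k t) ∧
      sglObj Y At lam α (Zt Z) ≤ sglObj Y At lam α Z) ∧
    (∀ Zhat : Fin K → Fin T → ℝ, (∀ k t, 0 ≤ Zhat k t) →
      (∀ W : Fin K → Fin T → ℝ, (∀ k t, 0 ≤ W k t) →
        sglObj Y At lam α Zhat ≤ sglObj Y At lam α W) →
      ((∀ W : Fin K → Fin T → ℝ, (∀ k t, 0 ≤ W k t) →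
          sglObj Y At lam α (Zt Zhat) ≤ sglObj Y At lam α W) ∧
        (∀ t, Zt Zhat i3 t = 0))) := by
  have h12 : i1 ≠ i2 := by intro h; rw [h] at hi1; omega
  have h13 : i1 ≠ i3 := by intro h; rw [h] at hi1; omega
  have h23 : i2 ≠ i3 := by intro h; rw [h] at hi2; omega
  have hA0 : ∀ p k, 0 ≤ A p k := fun p k => by
    rcases h01 p k with h | h <;> simp [h]
  have hsq : ∀ k, ∑ q, A q k ^ 2 = ∑ q, A q k := fun k =>
    Finset.sum_congr rfl fun p _ => by rcases h01 p k with h | h <;> simp [h]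
  have hpos : ∀ k, 0 < ∑ q, A q k := fun k => by
    obtain ⟨p, hp⟩ := Function.ne_iff.mp (hnz k)
    exact Finset.sum_pos' (fun q _ => hA0 q k)
      ⟨p, Finset.mem_univ _, lt_of_le_of_ne (hA0 p k) (Ne.symm hp)⟩
  have hs3 : ∑ p, A p i3 = ∑ p, A p i1 + ∑ p, A p i2 := by
    rw [← Finset.sum_add_distrib]; exact Finset.sum_congr rfl fun p _ => ha3 p
  have hp1 := hpos i1
  have hp2 := hpos i2
  have hp3 := hpos i3
  have hAt' : ∀ p k, At p k = A p k / ∑ q, A q k := fun p k => by rw [hAt, hsq]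
  generalize hS1 : ∑ p, A p i1 = s1 at *
  generalize hS2 : ∑ p, A p i2 = s2 at *
  generalize hS3 : ∑ p, A p i3 = s3 at *
  have hc1 : 0 ≤ s1 / s3 := by positivity
  have hc2 : 0 ≤ s2 / s3 := by positivity
  have hsum : s1 / s3 + s2 / s3 = 1 := by rw [← add_div, ← hs3, div_self hp3.ne']
  have z1 : ∀ Z, Zt Z i1 = fun t => Z i1 t + s1 / s3 * Z i3 t := fun Z => by
    ext t; simp [hZt]
  have z2 : ∀ Z, Zt Z i2 = fun t => Z i2 t + s2 / s3 * Z i3 t := fun Z => by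
    ext t; simp [hZt, h12.symm]
  have z3 : ∀ Z, Zt Z i3 = fun _ => 0 := fun Z => by
    ext t; simp [hZt, h13.symm, h23.symm]
  have zk : ∀ Z, ∀ k ∈ Finset.univ \ {i1, i2, i3}, Zt Z k = Z k := fun Z k hk => by
    simp only [Finset.mem_sdiff, Finset.mem_univ, true_and, Finset.mem_insert,
      Finset.mem_singleton, not_or] at hk
    ext t; simp [hZt, hk]
  have key : ∀ N : (Fin T → ℝ) → ℝ, N (fun _ => 0) = 0 →
      (∀ x y c, 0 ≤ c → N (fun t => x t + c * y t) ≤ N x + c * N y) →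
      ∀ Z, ∑ k, N (Zt Z k) ≤ ∑ k, N (Z k) := by
    intro N h0 hN Z
    rw [split3 i1 i2 i3 h12 h13 h23, split3 i1 i2 i3 h12 h13 h23 (fun k => N (Z k)),
      z1, z2, z3, h0, Finset.sum_congr rfl fun k hk => by rw [zk Z k hk]]
    have a := hN (Z i1) (Z i3) _ hc1
    have b := hN (Z i2) (Z i3) _ hc2
    have c : s1 / s3 * N (Z i3) + s2 / s3 * N (Z i3) = N (Z i3) := by
      rw [← add_mul, hsum, one_mul]
    linarith
  have main : ∀ Z : Fin K → Fin T → ℝ, (∀ k t, 0 ≤ Z k t) →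
      (∀ k t, 0 ≤ Zt Z k t) ∧
      (∀ p t, (∑ k, At p k * Zt Z k t) = ∑ k, At p k * Z k t) ∧
      sglObj Y At lam α (Zt Z) ≤ sglObj Y At lam α Z := by
    intro Z hZ
    have hfit : ∀ p t, (∑ k, At p k * Zt Z k t) = ∑ k, At p k * Z k t := by
      intro p t
      rw [split3 i1 i2 i3 h12 h13 h23, split3 i1 i2 i3 h12 h13 h23 (fun k => At p k * Z k t),
        z1, z2, z3, Finset.sum_congr rfl fun k hk => by rw [zk Z k hk],
        hAt' p i1, hAt' p i2, hAt' p i3, hS1, hS2, hS3, ha3]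
      field_simp
      ring
    refine ⟨fun k t => ?_, hfit, ?_⟩
    · rw [hZt]
      have := hZ i1 t
      have := hZ i2 t
      have := hZ i3 t
      have := hZ k t
      split_ifs <;> positivity
    · unfold sglObj
      simp only [hfit]
      have k1 := mul_le_mul_of_nonneg_left
        (key l1norm (by simp [l1norm]) l1norm_tri Z) (mul_nonneg hlam hα0)
      have k2 := mul_le_mul_of_nonneg_left
        (key l2norm (by simp [l2norm]) l2norm_tri Z) (mul_nonneg hlam (sub_nonneg.2 hα1))
      linarith
  exact ⟨main, fun Zhat h0 hmin => ⟨fun W hW => (main Zhat h0).2.2.trans (hmin W hW),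
    fun t => by rw [z3]⟩⟩
end
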